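/- Let K be an origin-symmetric planar convex body and μ an angular measure on ∂K giving measure π/2 to every closed antipode-free arc with Birkhoff-orthogonal endpoints. If x ∈ ∂K is not an Auerbach point, then there is an open arc of ∂K containing x with μ-measure zero (hence x is not in the support of μ). -/

import Mathlib

open Set MeasureTheory Pointwise

abbrev Plane := ℝ × ℝ

/-- An origin-symmetric convex body in the plane: compact, convex,
nonempty interior, symmetric about the origin. -/
def IsSymmConvexBody (K : Set Plane) : Prop :=
  Convex ℝ K ∧ IsCompact K ∧ (interior K).Nonempty ∧ K = -K

/-- Birkhoff orthogonality with respect to the norm induced by `K`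
(whose Minkowski functional is `gauge K`). -/
def BOrth (K : Set Plane) (x y : Plane) : Prop :=
  ∀ t : ℝ, gauge K x ≤ gauge K (x + t • y)

/-- The set of Auerbach points of `K`. -/
def Auerbach (K : Set Plane) : Set Plane :=
  {x | x ∈ frontier K ∧ ∃ y ∈ frontier K, BOrth K x y ∧ BOrth K y x}

/-- `E(K)`: the union of the open non-degenerate segments contained in `∂K`. -/
def SegUnion (K : Set Plane) : Set Plane :=
  {x | ∃ a b : Plane, a ≠ b ∧ segment ℝ a b ⊆ frontier K ∧ x ∈ openSegment ℝ a b}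

/-- A closed antipode-free arc of `∂K` with endpoints `x` and `y`:
a closed connected subset of `∂K` containing `x` and `y`, containing no
pair of antipodal points, and minimal with these properties. -/
def IsBArc (K C : Set Plane) (x y : Plane) : Prop :=
  C ⊆ frontier K ∧ IsClosed C ∧ IsPreconnected C ∧ x ∈ C ∧ y ∈ C ∧
  (∀ z ∈ C, -z ∉ C) ∧
  ∀ C' ⊆ C, IsClosed C' → IsPreconnected C' → x ∈ C' → y ∈ C' → C' = C

/-- An angular measure on `∂K`. -/
def IsAngularMeasure (K : Set Plane) (μ : Measure Plane) : Prop :=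
  μ (frontier K) = ENNReal.ofReal (2 * Real.pi) ∧
  μ (frontier K)ᶜ = 0 ∧
  (∀ X : Set Plane, μ (-X) = μ X) ∧
  (∀ x : Plane, μ {x} = 0)

/-- A B-measure: an angular measure giving `π/2` to every closed
antipode-free arc whose endpoints are Birkhoff orthogonal. -/
def IsBMeasure (K : Set Plane) (μ : Measure Plane) : Prop :=
  IsAngularMeasure K μ ∧
  ∀ C x y, IsBArc K C x y → BOrth K x y → μ C = ENNReal.ofReal (Real.pi / 2)

/-- The support of a Borel measure: the points all of whose open
neighborhoods have positive measure. -/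
def msupp {α : Type*} [TopologicalSpace α] [MeasurableSpace α]
    (μ : Measure α) : Set α :=
  {x | ∀ U : Set α, IsOpen U → x ∈ U → 0 < μ U}


/-- The (oriented) area form, with orientation `σ`. -/
noncomputable def om (σ : ℝ) (p q : Plane) : ℝ := σ * (p.1 * q.2 - p.2 * q.1)

/-- The unit circle with orientation `σ`. -/
noncomputable def ee (σ t : ℝ) : Plane := (Real.cos t, σ * Real.sin t)

/-- Radial parametrization of the boundary. -/
noncomputable def gam (K : Set Plane) (σ t : ℝ) : Plane := (gauge K (ee σ t))⁻¹ • ee σ t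

lemma om_ee {σ : ℝ} (hσ : σ * σ = 1) (a b : ℝ) : om σ (ee σ a) (ee σ b) = Real.sin (b - a) := by
  simp only [om, ee, Real.sin_sub]
  linear_combination (Real.cos a * Real.sin b - Real.sin a * Real.cos b) * hσ

lemma om_smul_left (σ s : ℝ) (p q : Plane) : om σ (s • p) q = s * om σ p q := by
  simp only [om, Prod.smul_fst, Prod.smul_snd, smul_eq_mul]; ring

lemma om_smul_right (σ s : ℝ) (p q : Plane) : om σ p (s • q) = s * om σ p q := by
  simp only [om, Prod.smul_fst, Prod.smul_snd, smul_eq_mul]; ring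

lemma om_add_left (σ : ℝ) (p p' q : Plane) : om σ (p + p') q = om σ p q + om σ p' q := by
  simp only [om, Prod.fst_add, Prod.snd_add]; ring

lemma om_add_right (σ : ℝ) (p q q' : Plane) : om σ p (q + q') = om σ p q + om σ p q' := by
  simp only [om, Prod.fst_add, Prod.snd_add]; ring

lemma om_self (σ : ℝ) (p : Plane) : om σ p p = 0 := by
  simp only [om]; ring

lemma om_swap (σ : ℝ) (p q : Plane) : om σ p q = - om σ q p := by
  simp only [om]; ring

lemma continuous_ee (σ : ℝ) : Continuous (ee σ) := by
  unfold ee; fun_prop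

lemma ee_ne {σ : ℝ} (hσ : σ * σ = 1) (t : ℝ) : ee σ t ≠ 0 := by
  intro h
  have h1 := congrArg Prod.fst h
  have h2 := congrArg Prod.snd h
  simp only [ee, Prod.fst_zero, Prod.snd_zero] at h1 h2
  have h3 : Real.sin t = 0 := by
    linear_combination σ * h2 - Real.sin t * hσ
  have := Real.sin_sq_add_cos_sq t
  rw [h1, h3] at this
  norm_num at this

lemma polar {σ : ℝ} (hσ : σ * σ = 1) (a : ℝ) (p : Plane) :
    ∃ t ∈ Ico a (a + 2 * Real.pi), ∃ s : ℝ, 0 ≤ s ∧ p = s • ee σ t := by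
  set z : ℂ := ⟨p.1, σ * p.2⟩ with hz
  obtain ⟨m, hm, -⟩ := existsUnique_add_zsmul_mem_Ico Real.two_pi_pos (Complex.arg z) a
  refine ⟨_, hm, ‖z‖, norm_nonneg _, ?_⟩
  have h1 := Complex.norm_mul_cos_arg z
  have h2 := Complex.norm_mul_sin_arg z
  simp only [hz] at h1 h2
  rw [← hz] at h1 h2
  ext
  · simp only [ee, Prod.smul_fst, smul_eq_mul, zsmul_eq_mul, Real.cos_add_int_mul_two_pi]
    exact h1.symm
  · simp only [ee, Prod.smul_snd, smul_eq_mul, zsmul_eq_mul, Real.sin_add_int_mul_two_pi]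
    linear_combination (-σ) * h2 - p.2 * hσ

/-- Normalized facts on a symmetric convex body. -/
structure Body (K : Set Plane) : Prop where
  cv : Convex ℝ K
  cp : IsCompact K
  nh : K ∈ nhds (0 : Plane)
  sy : ∀ p ∈ K, -p ∈ K

lemma Body.of {K : Set Plane} (h : IsSymmConvexBody K) : Body K := by
  obtain ⟨h1, h2, ⟨p, hp⟩, h4⟩ := h
  have sy : ∀ p ∈ K, -p ∈ K := by
    intro p hp
    rw [h4] at hp
    exact hp
  refine ⟨h1, h2, ?_, sy⟩
  have hq : -p ∈ K := sy _ (interior_subset hp)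
  have := h1.openSegment_interior_self_subset_interior hp hq
  rw [← mem_interior_iff_mem_nhds]
  apply this
  refine ⟨1/2, 1/2, by norm_num, by norm_num, by norm_num, ?_⟩
  simp

namespace Body

lemma fr_iff {K : Set Plane} (B : Body K) (p : Plane) : p ∈ frontier K ↔ gauge K p = 1 :=
  (gauge_eq_one_iff_mem_frontier B.cv B.nh).symm

lemma mem_iff {K : Set Plane} (B : Body K) (p : Plane) : p ∈ K ↔ gauge K p ≤ 1 := by
  rw [gauge_le_one_iff_mem_closure B.cv B.nh, B.cp.isClosed.closure_eq]

lemma cont {K : Set Plane} (B : Body K) : Continuous (gauge K) := continuous_gauge B.cv B.nh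

lemma pos {K : Set Plane} (B : Body K) {p : Plane} (hp : p ≠ 0) : 0 < gauge K p :=
  (gauge_pos (absorbent_nhds_zero B.nh)
    (NormedSpace.isVonNBounded_of_isBounded ℝ B.cp.isBounded)).2 hp

lemma add_le {K : Set Plane} (B : Body K) (p q : Plane) : gauge K (p + q) ≤ gauge K p + gauge K q :=
  gauge_add_le B.cv (absorbent_nhds_zero B.nh) p q

lemma fr_sub {K : Set Plane} (B : Body K) {p : Plane} (hp : p ∈ frontier K) : p ∈ K := by
  rw [B.mem_iff, (B.fr_iff p).1 hp]

lemma smul {K : Set Plane} (B : Body K) (s : ℝ) (hs : 0 ≤ s) (p : Plane) : gauge K (s • p) = s * gauge K p := by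
  rw [gauge_smul_of_nonneg hs, smul_eq_mul]

lemma norm_mem {K : Set Plane} (B : Body K) {p : Plane} (hp : p ≠ 0) : (gauge K p)⁻¹ • p ∈ frontier K := by
  have := B.pos hp
  rw [B.fr_iff, B.smul _ (by positivity), inv_mul_cancel₀ this.ne']


lemma gam_mem {K : Set Plane} (B : Body K) {σ : ℝ} (hσ : σ * σ = 1) (t : ℝ) : gam K σ t ∈ frontier K := B.norm_mem (ee_ne hσ t)

lemma gpos {K : Set Plane} (B : Body K) {σ : ℝ} (hσ : σ * σ = 1) (t : ℝ) : 0 < gauge K (ee σ t) := B.pos (ee_ne hσ t)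

lemma gam_cont {K : Set Plane} (B : Body K) {σ : ℝ} (hσ : σ * σ = 1) : Continuous (gam K σ) := by
  unfold gam
  exact ((B.cont.comp (continuous_ee σ)).inv₀ (fun t => (B.gpos hσ t).ne')).smul (continuous_ee σ)

lemma om_gam {K : Set Plane} (B : Body K) {σ : ℝ} (hσ : σ * σ = 1) (a b : ℝ) : om σ (gam K σ a) (gam K σ b) =
    ((gauge K (ee σ a))⁻¹ * (gauge K (ee σ b))⁻¹) * Real.sin (b - a) := by
  unfold gam
  rw [om_smul_left, om_smul_right, om_ee hσ]; ring

lemma om_gam_pos {K : Set Plane} (B : Body K) {σ : ℝ} (hσ : σ * σ = 1) (a b : ℝ) : 0 < om σ (gam K σ a) (gam K σ b) ↔ 0 < Real.sin (b - a) := by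
  rw [B.om_gam hσ]
  have h1 := B.gpos hσ a
  have h2 := B.gpos hσ b
  exact mul_pos_iff_of_pos_left (by positivity)

lemma exists_gam {K : Set Plane} (B : Body K) {σ : ℝ} (hσ : σ * σ = 1) (a : ℝ) {p : Plane} (hp : p ≠ 0) :
    ∃ t ∈ Ico a (a + 2 * Real.pi), ∃ s : ℝ, 0 < s ∧ p = s • gam K σ t := by
  obtain ⟨t, ht, s, hs, h⟩ := polar hσ a p
  have hs' : 0 < s := by
    rcases hs.eq_or_lt with h' | h'
    · rw [← h', zero_smul] at h; exact absurd h hp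
    · exact h'
  have := B.gpos hσ t
  refine ⟨t, ht, s * gauge K (ee σ t), by positivity, ?_⟩
  rw [gam, smul_smul, mul_assoc, mul_inv_cancel₀ this.ne', mul_one, h]

lemma exists_gam_fr {K : Set Plane} (B : Body K) {σ : ℝ} (hσ : σ * σ = 1) (a : ℝ) {p : Plane} (hp : p ∈ frontier K) :
    ∃ t ∈ Ico a (a + 2 * Real.pi), p = gam K σ t := by
  have hp1 := (B.fr_iff p).1 hp
  have h0 : p ≠ 0 := by
    rintro rfl
    rw [gauge_zero] at hp1; norm_num at hp1
  obtain ⟨t, ht, s, hs, h⟩ := B.exists_gam hσ a h0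
  refine ⟨t, ht, ?_⟩
  have h2 := (B.fr_iff _).1 (B.gam_mem hσ t)
  rw [h, B.smul s hs.le, h2, mul_one] at hp1
  rw [h, hp1, one_smul]

/-- position on the positive side -/
lemma exists_gam_pos {K : Set Plane} (B : Body K) {σ : ℝ} (hσ : σ * σ = 1) (a : ℝ) {p : Plane} (hp : 0 < om σ (gam K σ a) p) :
    ∃ t ∈ Ioo a (a + Real.pi), ∃ s : ℝ, 0 < s ∧ p = s • gam K σ t := by
  have h0 : p ≠ 0 := by
    rintro rfl
    simp [om] at hp
  obtain ⟨t, ht, s, hs, h⟩ := B.exists_gam hσ a h0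
  rw [h, om_smul_right, mul_pos_iff_of_pos_left hs, B.om_gam_pos hσ] at hp
  refine ⟨t, ⟨?_, ?_⟩, s, hs, h⟩
  · rcases ht.1.eq_or_lt with h' | h'
    · rw [h', sub_self, Real.sin_zero] at hp; exact absurd hp (lt_irrefl _)
    · exact h'
  · by_contra hcon
    push Not at hcon
    have : Real.sin (t - a) ≤ 0 := by
      rw [← neg_nonneg, ← Real.sin_sub_pi]
      exact Real.sin_nonneg_of_nonneg_of_le_pi (by linarith) (by linarith [ht.2])
    linarith

lemma gam_inj {K : Set Plane} (B : Body K) {σ : ℝ} (hσ : σ * σ = 1) {a b : ℝ} (hab : b < a + Real.pi) : InjOn (gam K σ) (Icc a b) := by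
  have key : ∀ s ∈ Icc a b, ∀ t ∈ Icc a b, s < t → gam K σ s ≠ gam K σ t := by
    intro s hs t ht hst h
    have : 0 < om σ (gam K σ s) (gam K σ t) := by
      rw [B.om_gam_pos hσ]
      exact Real.sin_pos_of_pos_of_lt_pi (by linarith) (by linarith [hs.1, ht.2])
    rw [h, om_self] at this
    exact lt_irrefl _ this
  intro s hs t ht h
  rcases lt_trichotomy s t with h' | h' | h'
  · exact absurd h (key s hs t ht h')
  · exact h'
  · exact absurd h.symm (key t ht s hs h')

lemma barc {K : Set Plane} (B : Body K) {σ : ℝ} (hσ : σ * σ = 1) {a b : ℝ} (h0 : a ≤ b) (hab : b < a + Real.pi) :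
    IsBArc K (gam K σ '' Icc a b) (gam K σ a) (gam K σ b) := by
  have hc := B.gam_cont hσ
  refine ⟨?_, (isCompact_Icc.image hc).isClosed, isPreconnected_Icc.image _ hc.continuousOn,
    ⟨a, ⟨le_rfl, h0⟩, rfl⟩, ⟨b, ⟨h0, le_rfl⟩, rfl⟩, ?_, ?_⟩
  · rintro _ ⟨t, -, rfl⟩
    exact B.gam_mem hσ t
  · rintro _ ⟨s, hs, rfl⟩ ⟨t, ht, h⟩
    have h1 : om σ (gam K σ s) (gam K σ t) = 0 := by
      rw [h]; simp only [om, Prod.fst_neg, Prod.snd_neg]; ring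
    have hst : s = t := by
      rw [B.om_gam hσ] at h1
      have g1 := B.gpos hσ s
      have g2 := B.gpos hσ t
      have h2 : Real.sin (t - s) = 0 := by
        rcases mul_eq_zero.1 h1 with h3 | h3
        · exact absurd h3 (by positivity)
        · exact h3
      have := (Real.sin_eq_zero_iff_of_lt_of_lt (by linarith [hs.2, ht.1]) (by linarith [hs.1, ht.2])).1 h2
      linarith
    subst hst
    have h3 : gam K σ s = 0 := by
      have := self_eq_neg.1 h
      exact this
    have h4 := (B.fr_iff _).1 (B.gam_mem hσ s)
    rw [h3, gauge_zero] at h4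
    norm_num at h4
  · intro C' hC' hcl hpre hxa hxb
    refine Subset.antisymm hC' ?_
    -- separation at a missing point
    rintro _ ⟨t, ht, rfl⟩
    by_contra hmem
    have hat : a < t := lt_of_le_of_ne ht.1 (by rintro rfl; exact hmem hxa)
    have htb : t < b := lt_of_le_of_ne ht.2 (by rintro rfl; exact hmem hxb)
    have hoc : Continuous (fun p => om σ (gam K σ t) p) := by unfold om; fun_prop
    have h1 : IsOpen {p | 0 < om σ (gam K σ t) p} := isOpen_lt continuous_const hoc
    have h2 : IsOpen {p | om σ (gam K σ t) p < 0} := isOpen_lt hoc continuous_const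
    have hlt : ∀ s ∈ Icc a b, s < t → om σ (gam K σ t) (gam K σ s) < 0 := by
      intro s hs hst
      rw [om_swap, neg_lt_zero, B.om_gam_pos hσ]
      exact Real.sin_pos_of_pos_of_lt_pi (by linarith) (by linarith [hs.1, ht.2])
    have hgt : ∀ s ∈ Icc a b, t < s → 0 < om σ (gam K σ t) (gam K σ s) := by
      intro s hs hst
      rw [B.om_gam_pos hσ]
      exact Real.sin_pos_of_pos_of_lt_pi (by linarith) (by linarith [hs.2, ht.1])
    obtain ⟨p, -, hp1, hp2⟩ := hpre _ _ h1 h2 (by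
      intro p hp
      obtain ⟨s, hs, rfl⟩ := hC' hp
      rcases lt_trichotomy s t with h' | h' | h'
      · exact Or.inr (hlt s hs h')
      · subst h'; exact absurd hp hmem
      · exact Or.inl (hgt s hs h'))
      ⟨_, hxb, hgt b ⟨h0, le_rfl⟩ htb⟩ ⟨_, hxa, hlt a ⟨le_rfl, h0⟩ hat⟩
    simp only [mem_ofPred_eq] at hp1 hp2
    exact lt_asymm hp1 hp2


lemma lin_le {K : Set Plane} (B : Body K) {f : Plane → ℝ} (hf : ∀ (s : ℝ) p, f (s • p) = s * f p) {M : ℝ}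
    (hM : ∀ k ∈ K, f k ≤ M) (p : Plane) : f p ≤ gauge K p * M := by
  by_cases hp : p = 0
  · subst hp
    have := hf 0 0
    rw [zero_smul, zero_mul] at this
    rw [this, gauge_zero, zero_mul]
  · have h := B.pos hp
    have h1 := hM _ (B.fr_sub (B.norm_mem hp))
    rw [hf, inv_mul_le_iff₀ h] at h1
    exact h1

/-- `x ⊣ y` from a supporting line at `x` in the direction of `y`. -/
lemma borth_of {K : Set Plane} (B : Body K) {x y : Plane} (σ : ℝ) (hx : x ∈ frontier K) (hpos : 0 < om σ x y)
    (h : ∀ k ∈ K, om σ k y ≤ om σ x y) : BOrth K x y := by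
  intro t
  rw [(B.fr_iff x).1 hx]
  have := B.lin_le (f := fun p => om σ p y) (fun s p => om_smul_left σ s p y) h (x + t • y)
  simp only [om_add_left, om_smul_left, om_self] at this
  rw [mul_zero, add_zero] at this
  exact le_of_mul_le_mul_right (by rw [one_mul]; exact this) hpos

lemma borth_of' {K : Set Plane} (B : Body K) {x y : Plane} (σ : ℝ) (hx : x ∈ frontier K) (hpos : 0 < om σ y x)
    (h : ∀ k ∈ K, om σ y k ≤ om σ y x) : BOrth K x y := by
  intro t
  rw [(B.fr_iff x).1 hx]
  have := B.lin_le (f := fun p => om σ y p) (fun s p => om_smul_right σ s y p) h (x + t • y)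
  simp only [om_add_right, om_smul_right, om_self] at this
  rw [mul_zero, add_zero] at this
  exact le_of_mul_le_mul_right (by rw [one_mul]; exact this) hpos

/-- Maximizers of a nonzero positive functional are in the boundary. -/
lemma fr_of_max {K : Set Plane} (B : Body K) {x y : Plane} (σ : ℝ) (hy : y ∈ K) (hpos : 0 < om σ x y)
    (h : ∀ k ∈ K, om σ x k ≤ om σ x y) : y ∈ frontier K := by
  rw [B.fr_iff]
  refine le_antisymm ((B.mem_iff y).1 hy) ?_
  have := B.lin_le (f := fun p => om σ x p) (fun s p => om_smul_right σ s x p) h y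
  nlinarith

/-- Supporting line. -/
lemma exists_support {K : Set Plane} (B : Body K) {σ : ℝ} (hσ : σ * σ = 1) {x : Plane} (hx : x ∈ frontier K) :
    ∃ w : Plane, 0 < om σ x w ∧ ∀ k ∈ K, om σ k w ≤ om σ x w := by
  have hxi : x ∉ interior K := hx.2
  obtain ⟨f, hf⟩ := geometric_hahn_banach_open_point B.cv.interior isOpen_interior hxi
  have h0 : (0 : Plane) ∈ interior K := mem_interior_iff_mem_nhds.2 B.nh
  have hrep : ∀ p : Plane, om σ p (-(σ * f (0, 1)), σ * f (1, 0)) = f p := by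
    intro p
    have : p = p.1 • ((1 : ℝ), (0 : ℝ)) + p.2 • ((0 : ℝ), (1 : ℝ)) := by
      ext <;> simp
    have h2 : f p = p.1 * f (1, 0) + p.2 * f (0, 1) := by
      conv_lhs => rw [this]
      rw [map_add, map_smul, map_smul, smul_eq_mul, smul_eq_mul]
    rw [h2]
    simp only [om]
    linear_combination (p.1 * f (1, 0) + p.2 * f (0, 1)) * hσ
  refine ⟨(-(σ * f (0, 1)), σ * f (1, 0)), ?_, ?_⟩
  · rw [hrep]
    have := hf 0 h0
    rwa [map_zero] at this
  · intro k hk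
    rw [hrep, hrep]
    have hcl : K ⊆ closure (interior K) := by
      rw [B.cv.closure_interior_eq_closure_of_nonempty_interior ⟨0, h0⟩]
      exact subset_closure
    have : closure (interior K) ⊆ {p | f p ≤ f x} :=
      closure_minimal (fun p hp => (hf p hp).le) (isClosed_le f.continuous continuous_const)
    exact this (hcl hk)

/-- The key geometric step. -/
lemma measure_arc {K : Set Plane} (B : Body K) {σ : ℝ} (hσ : σ * σ = 1) {μ : Measure Plane} (hμ : IsBMeasure K μ) {a b : ℝ} (hab : a < b)
    (hba : b < a + Real.pi) {d k : Plane} (hd : d ∈ K) (hk : k ∈ K)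
    (h1 : om σ (gam K σ a) (gam K σ b) < om σ (gam K σ a) d)
    (h2 : 0 < om σ (gam K σ b) d)
    (h3 : 0 < om σ (gam K σ a) k)
    (h4 : om σ (gam K σ a) (gam K σ b) < om σ k (gam K σ b)) :
    μ (gam K σ '' Icc a b) = ENNReal.ofReal (Real.pi / 2) := by
  set x := gam K σ a with hx
  set c := gam K σ b with hc
  have hxc : 0 < om σ x c := by
    rw [hx, hc, B.om_gam_pos hσ]
    exact Real.sin_pos_of_pos_of_lt_pi (by linarith) (by linarith)
  have hxf : x ∈ frontier K := B.gam_mem hσ a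
  have hcf : c ∈ frontier K := B.gam_mem hσ b
  -- lower arc
  have low : ∃ b1 ∈ Icc a b, μ (gam K σ '' Icc a b1) = ENNReal.ofReal (Real.pi / 2) := by
    obtain ⟨w, hw0, hw⟩ := B.exists_support hσ hxf
    obtain ⟨t, ht, s, hs, hws⟩ := B.exists_gam_pos hσ a hw0
    rw [hws, om_smul_right, mul_pos_iff_of_pos_left hs] at hw0
    have hw' : ∀ k ∈ K, om σ k (gam K σ t) ≤ om σ x (gam K σ t) := by
      intro k hk
      have := hw k hk
      rw [hws, om_smul_right, om_smul_right] at this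
      exact le_of_mul_le_mul_left this hs
    refine ⟨t, ⟨ht.1.le, ?_⟩, ?_⟩
    · by_contra hcon
      push Not at hcon
      -- y = gam t is after c
      have hcy : 0 < om σ c (gam K σ t) := by
        rw [hc, B.om_gam_pos hσ]
        exact Real.sin_pos_of_pos_of_lt_pi (by linarith) (by linarith [ht.2])
      have := hw' k hk
      set y := gam K σ t
      -- om x c * om k y = om x y * om k c + om c y * om x k
      have id1 : om σ x c * om σ k y = om σ x y * om σ k c + om σ c y * om σ x k := by
        simp only [om]; ring
      nlinarith [mul_pos hcy h3, mul_pos hw0 (sub_pos.2 h4)]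
    · exact hμ.2 _ _ _ (B.barc hσ ht.1.le ht.2) (B.borth_of σ hxf hw0 hw')
  have high : ∃ b2, b ≤ b2 ∧ μ (gam K σ '' Icc a b2) = ENNReal.ofReal (Real.pi / 2) := by
    have hoc : Continuous (fun p => om σ x p) := by unfold om; fun_prop
    obtain ⟨z, hzK, hz⟩ := B.cp.exists_isMaxOn ⟨k, hk⟩ hoc.continuousOn
    have hz' : ∀ k ∈ K, om σ x k ≤ om σ x z := fun k hk => hz hk
    have hxd := hz' d hd
    have hxz : 0 < om σ x z := by linarith
    have hzf := B.fr_of_max σ hzK hxz hz'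
    have hcz : 0 < om σ c z := by
      by_contra hcon
      push Not at hcon
      have hzc : 0 ≤ om σ z c := by rw [om_swap]; linarith
      have id1 : om σ x c * om σ z d = om σ x z * om σ c d + om σ x d * om σ z c := by
        simp only [om]; ring
      have hzd : 0 < om σ z d := by
        have : 0 < om σ x c * om σ z d := by
          rw [id1]; nlinarith [mul_pos hxz h2, mul_nonneg (hxc.trans h1).le hzc]
        exact (mul_pos_iff_of_pos_left hxc).1 this
      have id2 : om σ z d • c = om σ c d • z + om σ z c • d := by
        ext
        · simp only [om, Prod.smul_fst, Prod.fst_add, smul_eq_mul]; ring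
        · simp only [om, Prod.smul_snd, Prod.snd_add, smul_eq_mul]; ring
      have hN : om σ z d ≤ om σ c d + om σ z c := by
        have h5 := B.add_le (om σ c d • z) (om σ z c • d)
        rw [← id2, B.smul _ hzd.le, B.smul _ h2.le, B.smul _ hzc, (B.fr_iff c).1 hcf] at h5
        have h6 := (B.mem_iff z).1 hzK
        have h7 := (B.mem_iff d).1 hd
        nlinarith [mul_le_mul_of_nonneg_left h6 h2.le, mul_le_mul_of_nonneg_left h7 hzc]
      nlinarith [mul_le_mul_of_nonneg_left hxd h2.le, mul_pos hzd (sub_pos.2 h1), mul_le_mul_of_nonneg_left hN (hxc.trans h1).le]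
    obtain ⟨t, ht, s, hs, hzs⟩ := B.exists_gam_pos hσ a hxz
    have hs1 : s = 1 := by
      have e1 := (B.fr_iff z).1 hzf
      rw [hzs, B.smul s hs.le, (B.fr_iff _).1 (B.gam_mem hσ t), mul_one] at e1
      exact e1
    rw [hs1, one_smul] at hzs
    refine ⟨t, ?_, ?_⟩
    · rw [hzs, hc, B.om_gam_pos hσ] at hcz
      by_contra hcon
      push Not at hcon
      have : 0 < Real.sin (b - t) :=
        Real.sin_pos_of_pos_of_lt_pi (by linarith) (by linarith [ht.1])
      rw [← neg_sub, Real.sin_neg] at this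
      linarith
    · have hb := B.barc hσ ht.1.le ht.2
      have hb' : IsBArc K (gam K σ '' Icc a t) (gam K σ t) (gam K σ a) := by
        obtain ⟨i1, i2, i3, i4, i5, i6, i7⟩ := hb
        exact ⟨i1, i2, i3, i5, i4, i6, fun C' j1 j2 j3 j4 j5 => i7 C' j1 j2 j3 j5 j4⟩
      refine hμ.2 _ _ _ hb' ?_
      rw [← hzs]
      exact B.borth_of' σ hzf hxz hz'
  obtain ⟨b1, hb1, e1⟩ := low
  obtain ⟨b2, hb2, e2⟩ := high
  apply le_antisymm
  · rw [← e2]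
    exact measure_mono (image_mono (Icc_subset_Icc_right hb2))
  · rw [← e1]
    exact measure_mono (image_mono (Icc_subset_Icc_right hb1.2))

/-- Conclusion from an open configuration. -/
lemma concl {K : Set Plane} (B : Body K) {σ : ℝ} (hσ : σ * σ = 1) {μ : Measure Plane} (hμ : IsBMeasure K μ) {x c d k : Plane}
    (hx : x ∈ frontier K) (hc : c ∈ frontier K) (hd : d ∈ K) (hk : k ∈ K)
    (h0 : 0 < om σ x c) (h1 : om σ x c < om σ x d) (h2 : 0 < om σ c d)
    (h3 : 0 < om σ x k) (h4 : om σ x c < om σ k c) :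
    ∃ U : Set Plane, IsOpen U ∧ x ∈ U ∧ IsConnected (U ∩ frontier K) ∧
      μ (U ∩ frontier K) = 0 := by
  obtain ⟨θ, -, rfl⟩ := B.exists_gam_fr hσ 0 hx
  obtain ⟨b, hb, s, hs, hcs⟩ := B.exists_gam_pos hσ θ h0
  have hs1 : s = 1 := by
    have e1 := (B.fr_iff c).1 hc
    rw [hcs, B.smul s hs.le, (B.fr_iff _).1 (B.gam_mem hσ b), mul_one] at e1
    exact e1
  rw [hs1, one_smul] at hcs
  subst hcs
  have hgc := B.gam_cont hσ
  have hol : ∀ q, Continuous (fun t => om σ (gam K σ t) q) := by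
    intro q
    have : Continuous (fun p => om σ p q) := by unfold om; fun_prop
    exact this.comp hgc
  have ev : ∀ᶠ t in nhds θ, om σ (gam K σ t) (gam K σ b) < om σ (gam K σ t) d ∧
      0 < om σ (gam K σ t) k ∧ om σ (gam K σ t) (gam K σ b) < om σ k (gam K σ b) ∧
      t < b ∧ b - Real.pi < t := by
    have e1 := ((hol (gam K σ b)).tendsto θ).eventually_lt ((hol d).tendsto θ) h1
    have e2 := ((hol k).tendsto θ).eventually_const_lt h3
    have e3 := ((hol (gam K σ b)).tendsto θ).eventually_lt_const h4
    have e4 : ∀ᶠ t in nhds θ, t < b := eventually_lt_nhds hb.1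
    have e5 : ∀ᶠ t in nhds θ, b - Real.pi < t := eventually_gt_nhds (by linarith [hb.2])
    filter_upwards [e1, e2, e3, e4, e5] with t a1 a2 a3 a4 a5
    exact ⟨a1, a2, a3, a4, a5⟩
  obtain ⟨δ, hδ, hball⟩ := Metric.eventually_nhds_iff.1 ev
  have hm : ∀ t, |t - θ| < δ → μ (gam K σ '' Icc t b) = ENNReal.ofReal (Real.pi / 2) ∧ t < b ∧
      b - Real.pi < t := by
    intro t ht
    obtain ⟨a1, a2, a3, a4, a5⟩ := hball (show dist t θ < δ by rwa [Real.dist_eq])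
    exact ⟨B.measure_arc hσ hμ a4 (by linarith) hd hk a1 h2 a2 a3, a4, a5⟩
  set a1 := θ - δ / 2 with ha1
  set a2 := θ + δ / 2 with ha2
  obtain ⟨m1, l1, u1⟩ := hm a1 (by rw [ha1, abs_lt]; constructor <;> linarith)
  obtain ⟨m2, l2, u2⟩ := hm a2 (by rw [ha2, abs_lt]; constructor <;> linarith)
  have hpi : a2 < a1 + Real.pi := by linarith
  have hset : {p | 0 < om σ (gam K σ a1) p ∧ 0 < om σ p (gam K σ a2)} ∩ frontier K =
      gam K σ '' Ioo a1 a2 := by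
    ext p
    constructor
    · rintro ⟨⟨q1, q2⟩, hp⟩
      obtain ⟨t, ht, s, hs, hps⟩ := B.exists_gam_pos hσ a1 q1
      have hs1 : s = 1 := by
        have e1 := (B.fr_iff p).1 hp
        rw [hps, B.smul s hs.le, (B.fr_iff _).1 (B.gam_mem hσ t), mul_one] at e1
        exact e1
      rw [hs1, one_smul] at hps
      refine ⟨t, ⟨ht.1, ?_⟩, hps.symm⟩
      rw [hps, B.om_gam_pos hσ] at q2
      by_contra hcon
      push Not at hcon
      have : 0 ≤ Real.sin (t - a2) :=
        Real.sin_nonneg_of_nonneg_of_le_pi (by linarith) (by linarith [ht.2])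
      rw [← neg_sub, Real.sin_neg] at this
      linarith
    · rintro ⟨t, ht, rfl⟩
      refine ⟨⟨?_, ?_⟩, B.gam_mem hσ t⟩
      · rw [B.om_gam_pos hσ]
        exact Real.sin_pos_of_pos_of_lt_pi (by linarith [ht.1]) (by linarith [ht.2])
      · rw [B.om_gam_pos hσ]
        exact Real.sin_pos_of_pos_of_lt_pi (by linarith [ht.2]) (by linarith [ht.1])
  have hmem : θ ∈ Ioo a1 a2 := ⟨by linarith, by linarith⟩
  refine ⟨{p | 0 < om σ (gam K σ a1) p ∧ 0 < om σ p (gam K σ a2)}, ?_, ?_, ?_, ?_⟩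
  · have c1 : Continuous (fun p => om σ (gam K σ a1) p) := by unfold om; fun_prop
    have c2 : Continuous (fun p => om σ p (gam K σ a2)) := by unfold om; fun_prop
    exact (isOpen_lt continuous_const c1).inter (isOpen_lt continuous_const c2)
  · have : gam K σ θ ∈ gam K σ '' Ioo a1 a2 := ⟨θ, hmem, rfl⟩
    rw [← hset] at this
    exact this.1
  · rw [hset]
    exact (isConnected_Ioo (by linarith)).image _ hgc.continuousOn
  · rw [hset]
    have hsub : gam K σ '' Ioo a1 a2 ⊆ (gam K σ '' Icc a1 b) \ (gam K σ '' Icc a2 b) := by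
      rintro _ ⟨t, ht, rfl⟩
      refine ⟨⟨t, ⟨ht.1.le, by linarith [ht.2]⟩, rfl⟩, ?_⟩
      rintro ⟨s, hs, h⟩
      have := B.gam_inj hσ (a := a1) (b := b) (by linarith) ⟨by linarith [hs.1], hs.2⟩
        ⟨ht.1.le, by linarith [ht.2]⟩ h
      linarith [hs.1, ht.2]
    have hd := measure_sdiff (μ := μ) (s₁ := gam K σ '' Icc a1 b) (s₂ := gam K σ '' Icc a2 b)
      (image_mono (Icc_subset_Icc_left (by linarith)))
      (isCompact_Icc.image hgc).isClosed.measurableSet.nullMeasurableSet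
      (by rw [m2]; exact ENNReal.ofReal_ne_top)
    rw [m1, m2, tsub_self] at hd
    exact measure_mono_null hsub hd

lemma caseA {K : Set Plane} (B : Body K) {σ : ℝ} (hσ : σ * σ = 1) {μ : Measure Plane} (hμ : IsBMeasure K μ) {x w : Plane}
    (hx : x ∈ frontier K) (hnA : x ∉ Auerbach K)
    (hpos : 0 < om σ x w) (hw : ∀ k ∈ K, om σ k w ≤ om σ x w)
    (hJ : ∀ k ∈ K, om σ x k ≤ om σ x w) {r : ℝ} (hr : r ≤ 0) (hrK : w + r • x ∈ K) :
    ∃ U : Set Plane, IsOpen U ∧ x ∈ U ∧ IsConnected (U ∩ frontier K) ∧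
      μ (U ∩ frontier K) = 0 := by
  have hx1 := (B.fr_iff x).1 hx
  have hom : ∀ ρ : ℝ, om σ x (w + ρ • x) = om σ x w := by
    intro ρ; rw [om_add_right, om_smul_right, om_self]; ring
  -- points of the face of maximizers are not Auerbach partners
  have hno : ∀ ρ : ℝ, w + ρ • x ∈ K → ∃ k ∈ K, om σ x (w + ρ • x) < om σ k (w + ρ • x) := by
    intro ρ hρ
    by_contra hcon
    push Not at hcon
    apply hnA
    have hf : w + ρ • x ∈ frontier K :=
      B.fr_of_max σ (x := x) hρ (by rw [hom]; exact hpos) (by rw [hom]; exact hJ)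
    exact ⟨hx, _, hf, B.borth_of σ hx (by rw [hom]; exact hpos) hcon,
      B.borth_of' σ hf (by rw [hom]; exact hpos) (by rw [hom]; exact hJ)⟩
  have hlc : Continuous (fun ρ : ℝ => w + ρ • x) := by fun_prop
  have hT : IsCompact (Icc r 0 ∩ (fun ρ : ℝ => w + ρ • x) ⁻¹' K) :=
    isCompact_Icc.inter_right (B.cp.isClosed.preimage hlc)
  obtain ⟨r2, ⟨hr2, hr2K⟩, hmax⟩ := hT.exists_isGreatest ⟨r, ⟨le_rfl, hr⟩, hrK⟩
  obtain ⟨k, hk, hkk⟩ := hno r2 hr2K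
  have hr2neg : r2 < 0 := by
    rcases hr2.2.eq_or_lt with h | h
    · rw [h, zero_smul, add_zero] at hkk
      exact absurd (hw k hk) (not_le.2 hkk)
    · exact h
  have hxk : 0 < om σ x k := by
    have h1 := hw k hk
    rw [hom, om_add_right, om_smul_right, om_swap σ k x] at hkk
    by_contra hcon
    push Not at hcon
    nlinarith [mul_nonneg_of_nonpos_of_nonpos hr2neg.le hcon]
  -- choose ρ slightly larger than r2
  have hev : ∀ᶠ ρ in nhdsWithin r2 (Ioi r2), om σ x w < om σ k (w + ρ • x) ∧ ρ < 0 ∧ r2 < ρ := by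
    have hcf : Continuous (fun ρ : ℝ => om σ k (w + ρ • x)) := by unfold om; fun_prop
    rw [hom] at hkk
    have e1 := (hcf.tendsto r2).eventually_const_lt hkk
    have e2 : ∀ᶠ t in nhds r2, t < 0 := eventually_lt_nhds hr2neg
    filter_upwards [nhdsWithin_le_nhds e1, nhdsWithin_le_nhds e2, self_mem_nhdsWithin]
      with t a1 a2 a3
    exact ⟨a1, a2, a3⟩
  obtain ⟨ρ, q1, q2, q3⟩ := hev.exists
  have hnK : w + ρ • x ∉ K := fun h =>
    absurd (hmax ⟨⟨by linarith [hr2.1], q2.le⟩, h⟩) (not_le.2 q3)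
  have hN : 1 < gauge K (w + ρ • x) := by
    by_contra hcon
    exact hnK ((B.mem_iff _).2 (not_lt.1 hcon))
  set N := gauge K (w + ρ • x) with hNdef
  have hne : w + ρ • x ≠ 0 := by
    intro h; rw [hNdef, h, gauge_zero] at hN; linarith
  have hNi : 0 < N⁻¹ := by positivity
  refine B.concl hσ hμ (c := N⁻¹ • (w + ρ • x)) (d := w + r2 • x) (k := k) hx
    (B.norm_mem hne) hr2K hk ?_ ?_ ?_ hxk ?_
  · rw [om_smul_right, hom]; positivity
  · rw [om_smul_right, hom, hom]
    have : N⁻¹ < 1 := inv_lt_one_of_one_lt₀ hN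
    nlinarith
  · rw [om_smul_left]
    have : om σ (w + ρ • x) (w + r2 • x) = (ρ - r2) * om σ x w := by
      simp only [om, Prod.fst_add, Prod.snd_add, Prod.smul_fst, Prod.smul_snd, smul_eq_mul]; ring
    rw [this]
    have : 0 < ρ - r2 := by linarith
    positivity
  · rw [om_smul_right, om_smul_right, hom]
    exact mul_lt_mul_of_pos_left q1 hNi

end Body

/-- A non-Auerbach boundary point has an open arc neighborhood of measure
zero, hence lies outside the support of the B-measure. -/
theorem stmt_13 (K : Set Plane) (hK : IsSymmConvexBody K)
    (μ : Measure Plane) (hμ : IsBMeasure K μ)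
    (x : Plane) (hx : x ∈ frontier K) (hnA : x ∉ Auerbach K) :
    (∃ U : Set Plane, IsOpen U ∧ x ∈ U ∧ IsConnected (U ∩ frontier K) ∧
      μ (U ∩ frontier K) = 0) ∧ x ∉ msupp μ := by
  have B := Body.of hK
  have main : ∃ U : Set Plane, IsOpen U ∧ x ∈ U ∧ IsConnected (U ∩ frontier K) ∧
      μ (U ∩ frontier K) = 0 := by
    have h1 : (1 : ℝ) * 1 = 1 := by norm_num
    obtain ⟨w, hw0, hw⟩ := B.exists_support h1 hx
    have hoc : Continuous (fun p => om 1 x p) := by unfold om; fun_prop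
    obtain ⟨z, hzK, hz⟩ := B.cp.exists_isMaxOn ⟨x, B.fr_sub hx⟩ hoc.continuousOn
    have hz' : ∀ k ∈ K, om 1 x k ≤ om 1 x z := fun k hk => hz hk
    -- the maximum is positive
    have hzpos : 0 < om 1 x z := by
      have hwne : w ≠ 0 := by rintro rfl; simp [om] at hw0
      have h2 := hz' _ (B.fr_sub (B.norm_mem hwne))
      rw [om_smul_right] at h2
      have := B.pos hwne
      have : 0 < (gauge K w)⁻¹ * om 1 x w := by positivity
      linarith
    set s := om 1 x z / om 1 x w with hs
    have hspos : 0 < s := by positivity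
    have hsw : om 1 x (s • w) = om 1 x z := by
      rw [om_smul_right, hs]; field_simp
    have hw' : ∀ k ∈ K, om 1 k (s • w) ≤ om 1 x (s • w) := by
      intro k hk
      rw [om_smul_right, om_smul_right]
      exact mul_le_mul_of_nonneg_left (hw k hk) hspos.le
    set v := s • w with hv
    obtain ⟨r, hr⟩ : ∃ r : ℝ, z = v + r • x := by
      refine ⟨om 1 z v / om 1 x z, ?_⟩
      have hne : om 1 x z ≠ 0 := hzpos.ne'
      have id1 : om 1 x z • z = om 1 x z • v + om 1 z v • x := by
        have : om 1 x z • z = om 1 x v • z := by rw [hsw]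
        have id2 : om 1 x v • z = om 1 x z • v + om 1 z v • x := by
          ext
          · simp only [om, Prod.smul_fst, Prod.fst_add, smul_eq_mul]; ring
          · simp only [om, Prod.smul_snd, Prod.snd_add, smul_eq_mul]; ring
        rw [this, id2]
      have := congrArg (fun p => (om 1 x z)⁻¹ • p) id1
      simp only [smul_add, smul_smul, inv_mul_cancel₀ hne, one_smul] at this
      rw [div_eq_inv_mul]
      exact this
    have fl : ∀ p q : Plane, om (-1) p (-q) = om 1 p q := by
      intro p q; simp only [om, Prod.fst_neg, Prod.snd_neg]; ring
    rcases le_total r 0 with h | h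
    · exact B.caseA h1 hμ hx hnA (by rw [hsw]; exact hzpos) hw' (by rw [hsw]; exact hz') h
        (hr ▸ hzK)
    · refine B.caseA (σ := -1) (by norm_num) hμ hx hnA (w := -v) (by rw [fl, hsw]; exact hzpos)
        (by intro k hk; rw [fl, fl]; exact hw' k hk) ?_ (r := -r) (by linarith) ?_
      · intro k hk
        rw [fl, hsw]
        have := hz' _ (B.sy k hk)
        rwa [← fl, neg_neg] at this
      · have := B.sy z hzK
        rw [hr, neg_add] at this
        rw [neg_smul]
        exact this
  refine ⟨main, ?_⟩
  obtain ⟨U, hU, hxU, -, h0⟩ := main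
  intro hsupp
  have hp := hsupp U hU hxU
  have : μ U = 0 := by
    have hsub : U ⊆ (U ∩ frontier K) ∪ (frontier K)ᶜ := by
      intro p hp
      by_cases h : p ∈ frontier K
      · exact Or.inl ⟨hp, h⟩
      · exact Or.inr h
    exact measure_mono_null hsub (measure_union_null h0 hμ.1.2.1)
  exact hp.ne' this
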